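/- arXiv:2202.03024 — 2 statements merged into one kernel-verified Lean document; each statement's English description precedes it below -/
import Mathlib

section
/- Let y ∈ Σ_2^m be a binary word with exactly R runs and run length profile (r_1, …, r_R), and let x_β^y, x_γ^y, x_δ^y ∈ I_2(y) be the unique 2-supersequences of y whose run length profiles are (1,1,r_1,…,r_R), (2,r_1,…,r_R), and (1,r_1+1,r_2,…,r_R), respectively. Then: (1) ω_y(x_β^y) = 1 + Σ_{j=1}^{f_0} r_j, where f_0 is the smallest index j ∈ {1,…,R} with r_j > 1 (and f_0 = R if no such index exists); (2) ω_y(x_γ^y) = 1; and (3) ω_y(x_δ^y) = r_1 + 1. -/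
open scoped Classical

noncomputable section

/-- The embedding number `ω_y(x)`: the number of distinct occurrences of `y`
as a subsequence of `x` (i.e. the number of index tuples realizing `y` in `x`). -/
def emb {q : ℕ} (y x : List (Fin q)) : ℕ := x.sublists.count y

/-- The run length profile of a word: the list of lengths of its maximal
blocks of identical consecutive symbols, in order. -/
def runLengths {α : Type*} [DecidableEq α] : List α → List ℕ
  | [] => []
  | [_] => [1]
  | a :: b :: l =>
    if a = b then
      match runLengths (b :: l) with
      | [] => [1]
      | r :: rs => (r + 1) :: rs
    else 1 :: runLengths (b :: l)

/-- Input entropy `H^In_{k-Del}(y)` of the `k`-deletion channel over `Σ_q`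
under uniform transmission, for a channel output `y ∈ Σ_q^{n-k}`:
`-∑_{x ∈ I_k(y)} p(x) log₂ p(x)` with `p(x) = ω_y(x) / (C(n,k) q^k)`. -/
def Hdel (q n k : ℕ) (y : Fin (n - k) → Fin q) : ℝ :=
  - ∑ x ∈ Finset.univ.filter
      (fun x : Fin n → Fin q => (List.ofFn y).Sublist (List.ofFn x)),
      ((emb (List.ofFn y) (List.ofFn x) : ℝ) / ((n.choose k : ℝ) * (q : ℝ) ^ k)) *
        Real.logb 2 ((emb (List.ofFn y) (List.ofFn x) : ℝ) / ((n.choose k : ℝ) * (q : ℝ) ^ k))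

/-- Input entropy `H^In_{k-Ins}(y)` of the `k`-insertion channel over `Σ_q`
under uniform transmission, for a channel output `y ∈ Σ_q^{n+k}`:
`-∑_{x ∈ D_k(y)} p(x) log₂ p(x)` with `p(x) = ω_x(y) / C(n+k,k)`. -/
def Hins (q n k : ℕ) (y : Fin (n + k) → Fin q) : ℝ :=
  - ∑ x ∈ Finset.univ.filter
      (fun x : Fin n → Fin q => (List.ofFn x).Sublist (List.ofFn y)),
      ((emb (List.ofFn x) (List.ofFn y) : ℝ) / ((n + k).choose k : ℝ)) *
        Real.logb 2 ((emb (List.ofFn x) (List.ofFn y) : ℝ) / ((n + k).choose k : ℝ))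

/-- A run length profile `rl` of a word of length `m` with `R` runs is balanced if it
consists of `m mod R` runs of length `⌈m/R⌉` and `R - (m mod R)` runs of length `⌊m/R⌋`. -/
def isBalanced (m R : ℕ) (rl : List ℕ) : Prop :=
  rl.Perm (List.replicate (m % R) ((m + R - 1) / R) ++ List.replicate (R - m % R) (m / R))

/-- A run length profile `rl` of a word of length `m` with `R` runs is skewed if it
consists of `R - 1` runs of length `1` and a single run of length `m - (R-1)`. -/
def isSkewed (m R : ℕ) (rl : List ℕ) : Prop :=
  rl.Perm ((m - (R - 1)) :: List.replicate (R - 1) 1)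

/-- `fIdx rl i` is the smallest (1-based) index `j ∈ [i+1, R]` with `r_j > 1`;
it is `R` if no such index exists, and `fIdx rl R = R`. -/
def fIdx (rl : List ℕ) (i : ℕ) : ℕ :=
  if i = rl.length then rl.length
  else if {j | i + 1 ≤ j ∧ j ≤ rl.length ∧ 1 < rl.getD (j - 1) 0}.Nonempty
    then sInf {j | i + 1 ≤ j ∧ j ≤ rl.length ∧ 1 < rl.getD (j - 1) 0}
    else rl.length

/-- `bIdx rl i` is the largest (1-based) index `j ∈ [1, i]` with `r_j > 1`;
it is `1` if no such index exists, and `bIdx rl 0 = 1`. -/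
def bIdx (rl : List ℕ) (i : ℕ) : ℕ :=
  if i = 0 then 1
  else if {j | 1 ≤ j ∧ j ≤ i ∧ 1 < rl.getD (j - 1) 0}.Nonempty
    then sSup {j | 1 ≤ j ∧ j ≤ i ∧ 1 < rl.getD (j - 1) 0}
    else 1

theorem emb_nil_left {q : ℕ} (x : List (Fin q)) : emb [] x = 1 := by
  induction x with
  | nil => simp [emb]
  | cons b x ih =>
    unfold emb at ih ⊢
    rw [(List.sublists_cons_perm_append b x).count_eq, List.count_append, ih,
      List.count_eq_zero_of_not_mem (by simp)]

theorem emb_cons_nil {q : ℕ} (a : Fin q) (y : List (Fin q)) : emb (a :: y) [] = 0 := by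
  simp [emb]

theorem emb_cons_cons_self {q : ℕ} (a : Fin q) (y x : List (Fin q)) :
    emb (a :: y) (a :: x) = emb (a :: y) x + emb y x := by
  unfold emb
  rw [(List.sublists_cons_perm_append a x).count_eq, List.count_append,
    List.count_map_of_injective _ _ (List.cons_injective)]

theorem emb_cons_cons_of_ne {q : ℕ} {a b : Fin q} (h : a ≠ b) (y x : List (Fin q)) :
    emb (a :: y) (b :: x) = emb (a :: y) x := by
  unfold emb
  rw [(List.sublists_cons_perm_append b x).count_eq, List.count_append,
    List.count_eq_zero_of_not_mem (l := List.map _ _) (by simp [h.symm]), add_zero]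

theorem emb_eq_zero_of_length_lt {q : ℕ} {y x : List (Fin q)} (h : x.length < y.length) :
    emb y x = 0 :=
  List.count_eq_zero_of_not_mem fun hm => by
    have := (List.mem_sublists.1 hm).length_le
    omega

theorem emb_self {q : ℕ} (y : List (Fin q)) : emb y y = 1 := by
  induction y with
  | nil => exact emb_nil_left _
  | cons a y ih => rw [emb_cons_cons_self, ih, emb_eq_zero_of_length_lt (by simp)]

theorem runLengths_cons_ne_nil {α : Type*} [DecidableEq α] (a : α) (y : List α) :
    runLengths (a :: y) ≠ [] := by
  cases y with
  | nil => simp [runLengths]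
  | cons b y =>
    rw [runLengths]
    split_ifs
    · split <;> simp
    · simp

theorem runLengths_cons_cons_self {α : Type*} [DecidableEq α] (a : α) (y : List α) :
    runLengths (a :: a :: y) =
      ((runLengths (a :: y)).headI + 1) :: (runLengths (a :: y)).tail := by
  rw [runLengths, if_pos rfl]
  split
  · exact absurd ‹_› (runLengths_cons_ne_nil a y)
  · simp [*]

theorem runLengths_cons_cons_of_ne {α : Type*} [DecidableEq α] {a b : α} (h : a ≠ b)
    (y : List α) : runLengths (a :: b :: y) = 1 :: runLengths (b :: y) := by
  rw [runLengths, if_neg h]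

theorem runLengths_cons_headI_pos {α : Type*} [DecidableEq α] (a : α) (y : List α) :
    0 < (runLengths (a :: y)).headI := by
  cases y with
  | nil => simp [runLengths]
  | cons b y =>
    by_cases h : a = b
    · subst h
      simp [runLengths_cons_cons_self]
    · simp [runLengths_cons_cons_of_ne h]

/-- Duplicating the first symbol of a word embeds the word `r₁ + 1` times. -/
theorem emb_cons_duplicate_head {q : ℕ} [DecidableEq (Fin q)] (a : Fin q) (y : List (Fin q)) :
    emb (a :: y) (a :: a :: y) = (runLengths (a :: y)).headI + 1 := by
  induction y with
  | nil => rw [emb_cons_cons_self, emb_self, emb_nil_left]; simp [runLengths]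
  | cons b y ih =>
    rw [emb_cons_cons_self, emb_self]
    by_cases h : a = b
    · subst h
      rw [ih, runLengths_cons_cons_self, List.headI_cons, add_comm]
    · rw [emb_cons_cons_of_ne (Ne.symm h), emb_self, runLengths_cons_cons_of_ne h,
        List.headI_cons]

/-- The sum of the entries of a list up to and including the first entry exceeding `1`. -/
def sumThroughFirstLong : List ℕ → ℕ
  | [] => 0
  | r :: rs => if 1 < r then r else r + sumThroughFirstLong rs

theorem fIdx_nil_zero : fIdx [] 0 = 0 := by simp [fIdx]

theorem fIdx_cons_zero_of_one_lt {r : ℕ} (h : 1 < r) (rs : List ℕ) :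
    fIdx (r :: rs) 0 = 1 := by
  have hmem : 1 ∈ {j | 0 + 1 ≤ j ∧ j ≤ (r :: rs).length ∧ 1 < (r :: rs).getD (j - 1) 0} := by
    simpa using h
  rw [fIdx, if_neg (by simp), if_pos ⟨1, hmem⟩]
  exact le_antisymm (Nat.sInf_le hmem) (Nat.sInf_mem ⟨1, hmem⟩).1

theorem fIdx_cons_zero_of_le_one {r : ℕ} (h : r ≤ 1) (rs : List ℕ) :
    fIdx (r :: rs) 0 = fIdx rs 0 + 1 := by
  set S := {j | 0 + 1 ≤ j ∧ j ≤ rs.length ∧ 1 < rs.getD (j - 1) 0} with hS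
  set T := {j | 0 + 1 ≤ j ∧ j ≤ (r :: rs).length ∧ 1 < (r :: rs).getD (j - 1) 0} with hT
  have hST : ∀ j, j + 1 ∈ T ↔ j ∈ S := by
    rintro (_ | j)
    · simp [hS, hT, h]
    · simp [hS, hT]
  have hT0 : 0 ∉ T := by simp [hT]
  have hne : T.Nonempty ↔ S.Nonempty := by
    constructor
    · rintro ⟨_ | j, hj⟩
      · exact absurd hj hT0
      · exact ⟨j, (hST j).1 hj⟩
    · rintro ⟨j, hj⟩
      exact ⟨j + 1, (hST j).2 hj⟩
  rw [fIdx, if_neg (by simp), fIdx, ← hS, ← hT]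
  by_cases hs : S.Nonempty
  · have hlen : 0 ≠ rs.length := by
      obtain ⟨j, hj⟩ := hs
      have := hj.1
      have := hj.2.1
      omega
    rw [if_pos (hne.2 hs), if_neg hlen, if_pos hs]
    refine le_antisymm (Nat.sInf_le ((hST _).2 (Nat.sInf_mem hs))) ?_
    have hmem := Nat.sInf_mem (hne.2 hs)
    cases hk : sInf T with
    | zero => exact absurd (hk ▸ hmem) hT0
    | succ k => exact Nat.succ_le_succ (Nat.sInf_le ((hST k).1 (hk ▸ hmem)))
  · rw [if_neg (mt hne.1 hs), if_neg hs]
    simp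

theorem sum_Icc_fIdx_zero (rl : List ℕ) :
    ∑ j ∈ Finset.Icc 1 (fIdx rl 0), rl.getD (j - 1) 0 = sumThroughFirstLong rl := by
  simp only [← Finset.Ico_add_one_right_eq_Icc, Finset.sum_Ico_eq_sum_range,
    Nat.add_sub_cancel, Nat.add_sub_cancel_left]
  induction rl with
  | nil => simp [fIdx_nil_zero, sumThroughFirstLong]
  | cons r rs ih =>
    by_cases h : 1 < r
    · simp [fIdx_cons_zero_of_one_lt h, sumThroughFirstLong, h]
    · rw [fIdx_cons_zero_of_le_one (not_lt.1 h), Finset.sum_range_succ', sumThroughFirstLong,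
        if_neg h, ← ih]
      simp [add_comm]

/-- Prepending an alternating pair to a binary word. -/
theorem emb_cons_alternate [DecidableEq (Fin 2)] {a b : Fin 2} (hab : a ≠ b)
    (y : List (Fin 2)) :
    emb (a :: y) (a :: b :: a :: y) = 1 + sumThroughFirstLong (runLengths (a :: y)) := by
  induction y generalizing a b with
  | nil =>
    rw [emb_cons_cons_self, emb_cons_cons_of_ne hab, emb_self, emb_nil_left]
    simp [runLengths, sumThroughFirstLong]
  | cons c y ih =>
    rw [emb_cons_cons_self, emb_cons_cons_of_ne hab, emb_self]
    by_cases h : a = c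
    · subst h
      rw [emb_cons_cons_of_ne hab, emb_cons_duplicate_head, runLengths_cons_cons_self,
        sumThroughFirstLong, if_pos (Nat.succ_lt_succ (runLengths_cons_headI_pos a y))]
    · obtain rfl : b = c := by omega
      rw [ih hab.symm, runLengths_cons_cons_of_ne h, sumThroughFirstLong, if_neg (lt_irrefl 1)]

/-- Let `y ∈ Σ_2^m` be nonempty with run length profile `(r_1, …, r_R)`, and let
`x_β = y_1 ȳ_1 y`, `x_γ = ȳ_1 ȳ_1 y`, `x_δ = ȳ_1 y_1 y` be the unique 2-supersequences
of `y` with run length profiles `(1,1,r_1,…,r_R)`, `(2,r_1,…,r_R)` and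
`(1,r_1+1,r_2,…,r_R)` respectively (here `ȳ_1 = y_1 + 1` is the complement of `y_1`).
Then `ω_y(x_β) = 1 + ∑_{j=1}^{f_0} r_j`, `ω_y(x_γ) = 1` and `ω_y(x_δ) = r_1 + 1`. -/
theorem stmt_16 (y : List (Fin 2)) (hy : y ≠ []) :
    emb y (y.headI :: (y.headI + 1) :: y) =
        1 + ∑ j ∈ Finset.Icc 1 (fIdx (runLengths y) 0), (runLengths y).getD (j - 1) 0
    ∧ emb y ((y.headI + 1) :: (y.headI + 1) :: y) = 1
    ∧ emb y ((y.headI + 1) :: y.headI :: y) = (runLengths y).headI + 1 := by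
  cases y with
  | nil => exact absurd rfl hy
  | cons a y =>
    have hab : a ≠ a + 1 := by fin_cases a <;> decide
    simp only [List.headI_cons]
    refine ⟨?_, ?_, ?_⟩
    · rw [emb_cons_alternate hab, sum_Icc_fIdx_zero]
    · rw [emb_cons_cons_of_ne hab, emb_cons_cons_of_ne hab, emb_self]
    · rw [emb_cons_cons_of_ne hab, emb_cons_duplicate_head]

end
end

section
/- Let y ∈ Σ_2^m and x ∈ Σ_2^{m+2} be binary words, let α ∈ Σ_2, and let y' = α∘y and x' = α∘x. Let (r_1,…,r_R) be the run length profile of y and let x_β^y, x_γ^y, x_δ^y ∈ I_2(y) be the unique 2-supersequences of y with run length profiles (1,1,r_1,…,r_R), (2,r_1,…,r_R), and (1,r_1+1,r_2,…,r_R), respectively. If α ≠ y_1 or y_1 ≠ x_1, then: ω_{y'}(x') = ω_y(x) + 𝟙[x = x_β^y] when α ≠ y_1 and y_1 = x_1; ω_{y'}(x') = 2·ω_y(x) + 𝟙[x = x_γ^y] when α ≠ y_1 and y_1 ≠ x_1; and ω_{y'}(x') = ω_y(x) + 𝟙[x = x_δ^y] when α = y_1 and y_1 ≠ x_1. -/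
open scoped Classical

noncomputable section

theorem emb_cons_cons {q : ℕ} (a b : Fin q) (y x : List (Fin q)) :
    emb (a :: y) (b :: x) = emb (a :: y) x + if a = b then emb y x else 0 := by
  unfold emb
  rw [(List.sublists_perm_sublists' _).count_eq, (List.sublists_perm_sublists' _).count_eq,
    (List.sublists_perm_sublists' _).count_eq, List.sublists'_cons, List.count_append]
  congr 1
  split_ifs with hab
  · subst hab
    exact List.count_map_of_injective _ _ List.cons_injective _
  · refine List.count_eq_zero.2 fun hmem => ?_
    obtain ⟨z, -, hz⟩ := List.mem_map.1 hmem
    exact hab (List.cons.inj hz).1.symm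

theorem emb_of_length_eq {q : ℕ} {y x : List (Fin q)} (h : x.length = y.length) :
    emb y x = if x = y then 1 else 0 := by
  induction x generalizing y with
  | nil =>
    obtain rfl : y = [] := List.eq_nil_of_length_eq_zero h.symm
    simp [emb]
  | cons b x ih =>
    cases y with
    | nil => simp at h
    | cons a y =>
      simp only [List.length_cons, Nat.add_right_cancel_iff] at h
      rw [emb_cons_cons, emb_eq_zero_of_length_lt (by simp [h]), ih h]
      simp only [List.cons.injEq, eq_comm (a := a)]
      split_ifs <;> simp_all

theorem Fin.eq_add_one_of_ne {a b : Fin 2} (h : a ≠ b) : a = b + 1 := by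
  revert a b
  decide

/-- Let `y ∈ Σ_2^m` be nonempty, `x ∈ Σ_2^{m+2}`, `α ∈ Σ_2`, and set `y' = α∘y`,
`x' = α∘x`. Writing `x_β = y_1 ȳ_1 y`, `x_γ = ȳ_1 ȳ_1 y`, `x_δ = ȳ_1 y_1 y` for the
unique 2-supersequences of `y` with run length profiles `(1,1,r_1,…,r_R)`,
`(2,r_1,…,r_R)`, `(1,r_1+1,r_2,…,r_R)` (with `ȳ_1 = y_1 + 1`): if `α ≠ y_1` or
`y_1 ≠ x_1`, then `ω_{y'}(x') = ω_y(x) + 𝟙[x = x_β]` when `α ≠ y_1, y_1 = x_1`;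
`ω_{y'}(x') = 2 ω_y(x) + 𝟙[x = x_γ]` when `α ≠ y_1, y_1 ≠ x_1`; and
`ω_{y'}(x') = ω_y(x) + 𝟙[x = x_δ]` when `α = y_1, y_1 ≠ x_1`. -/
theorem stmt_17 (y x : List (Fin 2)) (hy : y ≠ []) (hxlen : x.length = y.length + 2)
    (α : Fin 2) (h : α ≠ y.headI ∨ y.headI ≠ x.headI) :
    (α ≠ y.headI → y.headI = x.headI →
      emb (α :: y) (α :: x) =
        emb y x + (if x = y.headI :: (y.headI + 1) :: y then 1 else 0))
    ∧ (α ≠ y.headI → y.headI ≠ x.headI →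
      emb (α :: y) (α :: x) =
        2 * emb y x + (if x = (y.headI + 1) :: (y.headI + 1) :: y then 1 else 0))
    ∧ (α = y.headI → y.headI ≠ x.headI →
      emb (α :: y) (α :: x) =
        emb y x + (if x = (y.headI + 1) :: y.headI :: y then 1 else 0)) := by
  obtain ⟨b, y, rfl⟩ := List.exists_cons_of_ne_nil hy
  cases x with
  | nil => simp at hxlen
  | cons c x =>
    have hlen : x.length = (α :: b :: y).length := by simpa using hxlen
    simp only [List.headI_cons]
    refine ⟨fun hα hc => ?_, fun hα hc => ?_, fun hα hc => ?_⟩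
    · subst hc
      rw [emb_cons_cons α α, emb_cons_cons α b, emb_of_length_eq hlen, if_neg hα, if_pos rfl]
      simp [Fin.eq_add_one_of_ne hα, add_comm]
    · obtain rfl : c = b + 1 := Fin.eq_add_one_of_ne hc.symm
      obtain rfl : α = b + 1 := Fin.eq_add_one_of_ne hα
      rw [emb_cons_cons (b + 1) (b + 1) (b :: y) ((b + 1) :: x), emb_cons_cons (b + 1) (b + 1),
        emb_of_length_eq hlen, if_pos rfl, if_pos rfl, emb_cons_cons b (b + 1), if_neg hc]
      simp only [List.cons.injEq, true_and]
      ring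
    · subst hα
      rw [emb_cons_cons α α, emb_cons_cons α c (α :: y), emb_of_length_eq hlen, if_neg hc,
        if_pos rfl]
      simp [Fin.eq_add_one_of_ne hc.symm, add_comm]

end
end
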